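/- Let G be a spray of scalar curvature on an open set U ⊆ ℝⁿ (n ≥ 2) and let dV = σ(x) dx¹⋯dxⁿ be any volume form on U. Then the spray Ĝ associated with (G, dV), defined by Ĝⁱ := Gⁱ − (S/(n+1)) yⁱ where S is the S-curvature of (G, dV), is of isotropic curvature. -/

import Mathlib

open scoped BigOperators

noncomputable section

/-- Points/vectors in local coordinates on an open subset of `ℝⁿ`. -/
abbrev Vec (n : ℕ) := Fin n → ℝ

variable {n : ℕ}

/-- Partial derivative in the base (`x`) variable, in the `k`-th coordinate direction. -/
noncomputable def pdx (f : Vec n → Vec n → ℝ) (k : Fin n) (x y : Vec n) : ℝ :=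
  fderiv ℝ (fun x' => f x' y) x (Pi.single k 1)

/-- Partial derivative in the fiber (`y`) variable, in the `k`-th coordinate direction;
this is the operation denoted by a subscript `·k`. -/
noncomputable def pdy (f : Vec n → Vec n → ℝ) (k : Fin n) (x y : Vec n) : ℝ :=
  fderiv ℝ (fun y' => f x y') y (Pi.single k 1)

/-- Partial derivative of a function of `x` alone. -/
noncomputable def pd (f : Vec n → ℝ) (k : Fin n) (x : Vec n) : ℝ :=
  fderiv ℝ f x (Pi.single k 1)

/-- `G` is a spray on the open set `U ⊆ ℝⁿ`: the coefficients `Gⁱ(x,y)` are smooth for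
`x ∈ U`, `y ≠ 0`, and positively homogeneous of degree `2` in `y`. -/
def IsSpray (U : Set (Vec n)) (G : Fin n → Vec n → Vec n → ℝ) : Prop :=
  (∀ i, ContDiffOn ℝ (⊤ : ℕ∞) (fun p : Vec n × Vec n => G i p.1 p.2)
      (U ×ˢ {y : Vec n | y ≠ 0})) ∧
  (∀ i (x y : Vec n) (lam : ℝ), 0 < lam → G i x (lam • y) = lam ^ 2 * G i x y)

/-- `N^i_j := ∂G^i/∂y^j`. -/
noncomputable def Nc (G : Fin n → Vec n → Vec n → ℝ) (i j : Fin n) (x y : Vec n) : ℝ :=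
  pdy (G i) j x y

/-- `Γ^i_{jk} := ∂²G^i/∂y^j∂y^k`. -/
noncomputable def Ga (G : Fin n → Vec n → Vec n → ℝ) (i j k : Fin n) (x y : Vec n) : ℝ :=
  pdy (Nc G i j) k x y

/-- The horizontal derivative `δf/δx^k := ∂f/∂x^k − N^m_k ∂f/∂y^m`; for a scalar `f` this is
also the horizontal covariant derivative `f_{|k}`. -/
noncomputable def hd (G : Fin n → Vec n → Vec n → ℝ) (f : Vec n → Vec n → ℝ)
    (k : Fin n) (x y : Vec n) : ℝ :=
  pdx f k x y - ∑ m, Nc G m k x y * pdy f m x y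

/-- The four-index Riemann curvature tensor
`R_j{}^i{}_{kl} := δΓⁱ_{jl}/δx^k − δΓⁱ_{jk}/δx^l + Γⁱ_{ks}Γ^s_{jl} − Γ^s_{jk}Γⁱ_{ls}`. -/
noncomputable def Riem4 (G : Fin n → Vec n → Vec n → ℝ) (j i k l : Fin n)
    (x y : Vec n) : ℝ :=
  hd G (Ga G i j l) k x y - hd G (Ga G i j k) l x y
    + ∑ s, (Ga G i k s x y * Ga G s j l x y - Ga G s j k x y * Ga G i l s x y)

/-- The two-index Riemann curvature `R^i_k := y^j R_j{}^i{}_{kl} y^l`. -/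
noncomputable def Riem2 (G : Fin n → Vec n → Vec n → ℝ) (i k : Fin n)
    (x y : Vec n) : ℝ :=
  ∑ j, ∑ l, y j * Riem4 G j i k l x y * y l

/-- The χ-curvature `χ_k := −(1/6)(2 R^m_{k·m} + R^m_{m·k})`. -/
noncomputable def chi (G : Fin n → Vec n → Vec n → ℝ) (k : Fin n) (x y : Vec n) : ℝ :=
  -(1 / 6) * (2 * ∑ m, pdy (Riem2 G m k) m x y + ∑ m, pdy (Riem2 G m m) k x y)

/-- The scalar `R := (1/(n−1)) R^m_m`. -/
noncomputable def Rsc (G : Fin n → Vec n → Vec n → ℝ) (x y : Vec n) : ℝ :=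
  (1 / ((n : ℝ) - 1)) * ∑ m, Riem2 G m m x y

/-- `Π := ∂G^m/∂y^m`. -/
noncomputable def PiG (G : Fin n → Vec n → Vec n → ℝ) (x y : Vec n) : ℝ :=
  ∑ m, Nc G m m x y

/-- The S-curvature of `(G, dV)` for the volume form `dV = σ(x) dx¹⋯dxⁿ`:
`S := Π − y^m ∂(ln σ)/∂x^m`. -/
noncomputable def Scurv (G : Fin n → Vec n → Vec n → ℝ) (σ : Vec n → ℝ)
    (x y : Vec n) : ℝ :=
  PiG G x y - ∑ m, y m * pd (fun x' => Real.log (σ x')) m x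

/-- The spray `Ĝ` associated with `(G, dV)`: `Ĝⁱ := Gⁱ − (S/(n+1)) yⁱ`. -/
noncomputable def Ghat (G : Fin n → Vec n → Vec n → ℝ) (σ : Vec n → ℝ)
    (i : Fin n) (x y : Vec n) : ℝ :=
  G i x y - (Scurv G σ x y / ((n : ℝ) + 1)) * y i

/-- `σ` is the (positive, smooth) density of a volume form `dV = σ(x) dx¹⋯dxⁿ` on `U`. -/
def IsVolumeForm (U : Set (Vec n)) (σ : Vec n → ℝ) : Prop :=
  ContDiffOn ℝ (⊤ : ℕ∞) σ U ∧ ∀ x ∈ U, 0 < σ x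

/-- `G` is of isotropic curvature on `U`: `Rⁱ_k = R δⁱ_k − (1/2) R_{·k} yⁱ`. -/
def IsIsotropicCurv (U : Set (Vec n)) (G : Fin n → Vec n → Vec n → ℝ) : Prop :=
  ∀ x ∈ U, ∀ y : Vec n, y ≠ 0 → ∀ i k,
    Riem2 G i k x y
      = Rsc G x y * (if i = k then 1 else 0) - (1 / 2) * pdy (Rsc G) k x y * y i

/-- `G` is of scalar curvature on `U`: `Rⁱ_k = R δⁱ_k − τ_k yⁱ` for some functions `τ_k`,
positively homogeneous of degree one in `y`, with `τ_k y^k = R`. -/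
def IsScalarCurv (U : Set (Vec n)) (G : Fin n → Vec n → Vec n → ℝ) : Prop :=
  ∃ τ : Fin n → Vec n → Vec n → ℝ,
    (∀ k (x y : Vec n) (lam : ℝ), 0 < lam → τ k x (lam • y) = lam * τ k x y) ∧
    ∀ x ∈ U, ∀ y : Vec n, y ≠ 0 →
      (∑ k, τ k x y * y k) = Rsc G x y ∧
      ∀ i k, Riem2 G i k x y
        = Rsc G x y * (if i = k then 1 else 0) - τ k x y * y i

/-- A commutative `ℝ`-algebra that looks like an algebra of smooth functions of `(x, y)`:
commuting derivations `dx k`, `dy k` and the fiber coordinates `y i`. -/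
structure FiberedDiffAlg (n : ℕ) (A : Type*) [CommRing A] [Algebra ℝ A] where
  dx : Fin n → Derivation ℝ A A
  dy : Fin n → Derivation ℝ A A
  y : Fin n → A
  dx_comm : ∀ j k a, dx j (dx k a) = dx k (dx j a)
  dx_dy : ∀ j k a, dx j (dy k a) = dy k (dx j a)
  dy_comm : ∀ j k a, dy j (dy k a) = dy k (dy j a)
  dx_y : ∀ k i, dx k (y i) = 0
  dy_y : ∀ k i, dy k (y i) = if i = k then 1 else 0

namespace FiberedDiffAlg

variable {A : Type*} [CommRing A] [Algebra ℝ A] (F : FiberedDiffAlg n A)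

/-- The Berwald connection coefficients. -/
def gam (g : Fin n → A) (i j k : Fin n) : A := F.dy k (F.dy j (g i))

/-- The horizontal derivative. -/
def hder (g : Fin n → A) (a : A) (k : Fin n) : A :=
  F.dx k a - ∑ m, F.dy k (g m) * F.dy m a

/-- The four-index Riemann curvature. -/
def riem4 (g : Fin n → A) (j i k l : Fin n) : A :=
  F.hder g (F.gam g i j l) k - F.hder g (F.gam g i j k) l
    + ∑ s, (F.gam g i k s * F.gam g s j l - F.gam g s j k * F.gam g i l s)

/-- The two-index Riemann curvature. -/
def riem2 (g : Fin n → A) (i k : Fin n) : A :=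
  ∑ j, ∑ l, F.y j * F.riem4 g j i k l * F.y l

/-- The derivation `y^l ∂/∂x^l - 2 g^m ∂/∂y^m`. -/
def sprayDer (g : Fin n → A) (a : A) : A :=
  ∑ l, F.y l * F.dx l a - 2 * ∑ m, g m * F.dy m a

/-- The Euler (Liouville) derivation `y^m ∂/∂y^m`. -/
def euler (a : A) : A := ∑ m, F.y m * F.dy m a

lemma dy_two (k : Fin n) (a : A) : F.dy k (2 * a) = 2 * F.dy k a := by
  rw [two_mul, map_add, two_mul]

lemma dy_ofNat_two (k : Fin n) : F.dy k (2 : A) = 0 := by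
  simpa using (F.dy k).map_natCast 2

lemma dx_two (k : Fin n) (a : A) : F.dx k (2 * a) = 2 * F.dx k a := by
  rw [two_mul, map_add, two_mul]

lemma euler_add (a b : A) : F.euler (a + b) = F.euler a + F.euler b := by
  simp only [euler, map_add, mul_add, Finset.sum_add_distrib]

lemma euler_mul (a b : A) : F.euler (a * b) = a * F.euler b + F.euler a * b := by
  simp only [euler, Derivation.leibniz, smul_eq_mul, mul_add, Finset.sum_add_distrib,
    Finset.mul_sum, Finset.sum_mul]
  congr 1 <;> exact Finset.sum_congr rfl fun _ _ => by ring

lemma euler_y (i : Fin n) : F.euler (F.y i) = F.y i := by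
  simp [euler, F.dy_y]

lemma dy_euler (k : Fin n) (a : A) : F.dy k (F.euler a) = F.euler (F.dy k a) + F.dy k a := by
  simp [euler, F.dy_y, F.dy_comm k, Finset.sum_add_distrib]

lemma dx_euler (k : Fin n) (a : A) : F.dx k (F.euler a) = F.euler (F.dx k a) := by
  simp [euler, F.dx_y, F.dx_dy]

lemma sprayDer_add (g : Fin n → A) (a b : A) :
    F.sprayDer g (a + b) = F.sprayDer g a + F.sprayDer g b := by
  simp only [sprayDer, map_add, mul_add, Finset.sum_add_distrib]
  ring

lemma sprayDer_mul (g : Fin n → A) (a b : A) :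
    F.sprayDer g (a * b) = a * F.sprayDer g b + F.sprayDer g a * b := by
  simp only [sprayDer, Derivation.leibniz, smul_eq_mul, mul_add, Finset.sum_add_distrib,
    mul_sub, sub_mul, Finset.mul_sum, Finset.sum_mul]
  have h : ∀ (u v c d : Fin n → A), u = c → v = d → ∑ i, u i + ∑ i, v i = ∑ i, c i + ∑ i, d i := by
    rintro _ _ _ _ rfl rfl; rfl
  rw [sub_add_sub_comm]
  congr 1 <;> exact h _ _ _ _ (by ext; ring) (by ext; ring)

lemma sprayDer_sum {ι : Type*} (s : Finset ι) (g : Fin n → A) (a : ι → A) :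
    F.sprayDer g (∑ i ∈ s, a i) = ∑ i ∈ s, F.sprayDer g (a i) := by
  classical
  induction s using Finset.induction_on with
  | empty => simp [sprayDer]
  | insert i s hi ih => rw [Finset.sum_insert hi, Finset.sum_insert hi, sprayDer_add, ih]

lemma sprayDer_y (g : Fin n → A) (i : Fin n) : F.sprayDer g (F.y i) = -2 * g i := by
  simp [sprayDer, F.dy_y, F.dx_y]

/-- The commutator of a vertical derivative with the spray derivation. -/
lemma dy_sprayDer (g : Fin n → A) (k : Fin n) (a : A) :
    F.dy k (F.sprayDer g a) =
      F.sprayDer g (F.dy k a) + F.dx k a - 2 * ∑ m, F.dy k (g m) * F.dy m a := by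
  have h : ∀ m, F.dy m a * F.dy k (g m) = F.dy k (g m) * F.dy m a := fun m => mul_comm _ _
  simp only [sprayDer, map_sub, map_sum, dy_ofNat_two, Derivation.leibniz, smul_eq_mul, F.dy_y,
    F.dx_dy, F.dy_comm k, Finset.sum_add_distrib, mul_ite, mul_one, mul_zero, h,
    Finset.sum_ite_eq', Finset.mem_univ, if_true]
  ring

lemma euler_dy {g : Fin n → A} (hg : ∀ i, F.euler (g i) = 2 * g i) (i k : Fin n) :
    F.euler (F.dy k (g i)) = F.dy k (g i) := by
  have := F.dy_euler k (g i)
  rw [hg, dy_two] at this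
  linear_combination -this

lemma euler_dy_dy {g : Fin n → A} (hg : ∀ i, F.euler (g i) = 2 * g i) (i j k : Fin n) :
    F.euler (F.dy k (F.dy j (g i))) = 0 := by
  have := F.dy_euler k (F.dy j (g i))
  rw [F.euler_dy hg] at this
  linear_combination -this

lemma sum_y_gam {g : Fin n → A} (hg : ∀ i, F.euler (g i) = 2 * g i) (i k : Fin n) :
    ∑ j, F.y j * F.gam g i j k = F.dy k (g i) := by
  simpa [gam, F.dy_comm k, euler] using F.euler_dy hg i k

lemma sum_y_dx_gam {g : Fin n → A} (hg : ∀ i, F.euler (g i) = 2 * g i) (i k l : Fin n) :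
    ∑ j, F.y j * F.dx l (F.gam g i j k) = F.dx l (F.dy k (g i)) := by
  rw [← F.sum_y_gam hg]
  simp [F.dx_y]

lemma sum_y_dy_gam {g : Fin n → A} (hg : ∀ i, F.euler (g i) = 2 * g i) (i k l : Fin n) :
    ∑ j, F.y j * F.dy l (F.gam g i j k) = 0 := by
  rw [← F.euler_dy_dy hg i k l, euler]
  exact Finset.sum_congr rfl fun j _ => by rw [gam, F.dy_comm k j, F.dy_comm l j]

lemma sum_y_hder_gam {g : Fin n → A} (hg : ∀ i, F.euler (g i) = 2 * g i) (i k l : Fin n) :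
    ∑ j, F.y j * F.hder g (F.gam g i j k) l = F.dx l (F.dy k (g i)) := by
  simp only [hder, mul_sub, Finset.sum_sub_distrib, F.sum_y_dx_gam hg, Finset.mul_sum]
  rw [Finset.sum_comm, sub_eq_self]
  refine Finset.sum_eq_zero fun m _ => ?_
  have h := F.sum_y_dy_gam hg i k m
  calc _ = F.dy l (g m) * ∑ j, F.y j * F.dy m (F.gam g i j k) := by
        rw [Finset.mul_sum]; exact Finset.sum_congr rfl fun _ _ => by ring
    _ = 0 := by rw [h, mul_zero]

lemma sum_y_riem4 {g : Fin n → A} (hg : ∀ i, F.euler (g i) = 2 * g i) (i k l : Fin n) :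
    ∑ j, F.y j * F.riem4 g j i k l = F.dx k (F.dy l (g i)) - F.dx l (F.dy k (g i)) +
      ∑ s, (F.gam g i k s * F.dy l (g s) - F.dy k (g s) * F.gam g i l s) := by
  simp only [riem4, mul_add, mul_sub, Finset.sum_add_distrib, Finset.sum_sub_distrib,
    F.sum_y_hder_gam hg, Finset.mul_sum]
  congr 2
  · rw [Finset.sum_comm]
    refine Finset.sum_congr rfl fun s _ => ?_
    rw [← F.sum_y_gam hg, Finset.mul_sum]
    exact Finset.sum_congr rfl fun _ _ => by ring
  · rw [Finset.sum_comm]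
    refine Finset.sum_congr rfl fun s _ => ?_
    rw [← F.sum_y_gam hg, Finset.sum_mul]
    exact Finset.sum_congr rfl fun _ _ => by ring

/-- The classical expression of the Riemann curvature in terms of the spray coefficients. -/
lemma riem2_eq {g : Fin n → A} (hg : ∀ i, F.euler (g i) = 2 * g i) (i k : Fin n) :
    F.riem2 g i k = 2 * F.dx k (g i) - F.sprayDer g (F.dy k (g i))
      - ∑ m, F.dy m (g i) * F.dy k (g m) := by
  have h1 : F.riem2 g i k = ∑ l, F.y l * ∑ j, F.y j * F.riem4 g j i k l := by
    rw [riem2, Finset.sum_comm]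
    refine Finset.sum_congr rfl fun l _ => ?_
    rw [Finset.mul_sum]
    exact Finset.sum_congr rfl fun _ _ => by ring
  have h2 : ∑ l, F.y l * F.dx k (F.dy l (g i)) = 2 * F.dx k (g i) := by
    rw [← dx_two, ← hg, dx_euler, euler]
    exact Finset.sum_congr rfl fun _ _ => by rw [F.dx_dy]
  have h3 : ∑ l, ∑ s, F.y l * (F.gam g i k s * F.dy l (g s)) =
      2 * ∑ s, g s * F.dy s (F.dy k (g i)) := by
    rw [Finset.sum_comm, Finset.mul_sum]
    refine Finset.sum_congr rfl fun s _ => ?_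
    rw [← mul_assoc, ← hg, euler, Finset.sum_mul]
    exact Finset.sum_congr rfl fun _ _ => by rw [gam]; ring
  have h4 : ∑ l, ∑ s, F.y l * (F.dy k (g s) * F.gam g i l s) =
      ∑ m, F.dy m (g i) * F.dy k (g m) := by
    rw [Finset.sum_comm]
    refine Finset.sum_congr rfl fun s _ => ?_
    rw [← F.sum_y_gam hg i s, Finset.sum_mul]
    exact Finset.sum_congr rfl fun _ _ => by ring
  simp only [h1, F.sum_y_riem4 hg, mul_add, mul_sub, Finset.sum_add_distrib,
    Finset.sum_sub_distrib, Finset.mul_sum, h2, h3, h4, sprayDer]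
  ring

/-- The χ-curvature is governed by the divergence of the spray. -/
lemma dy_trace_identity {g : Fin n → A} (hg : ∀ i, F.euler (g i) = 2 * g i) (k : Fin n) :
    2 * ∑ m, F.dy m (F.riem2 g m k) + F.dy k (∑ m, F.riem2 g m m) =
      3 * (F.dx k (∑ m, F.dy m (g m)) - F.sprayDer g (F.dy k (∑ m, F.dy m (g m)))) := by
  simp only [F.riem2_eq hg, map_sub, map_sum, dy_sprayDer, dy_ofNat_two, Derivation.leibniz,
    smul_eq_mul, mul_zero, Finset.sum_const_zero, Finset.sum_sub_distrib, Finset.sum_add_distrib,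
    ← Finset.mul_sum, sprayDer_sum]
  have c1 : ∑ m, F.dy m (F.dx k (g m)) = ∑ m, F.dx k (F.dy m (g m)) :=
    Finset.sum_congr rfl fun _ _ => (F.dx_dy _ _ _).symm
  have c2 : ∑ m, F.sprayDer g (F.dy m (F.dy k (g m))) =
      ∑ m, F.sprayDer g (F.dy k (F.dy m (g m))) :=
    Finset.sum_congr rfl fun _ _ => by rw [F.dy_comm]
  have c3 : ∑ m, F.dy k (F.dx m (g m)) = ∑ m, F.dx m (F.dy k (g m)) :=
    Finset.sum_congr rfl fun _ _ => (F.dx_dy _ _ _).symm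
  have c4 : ∑ m, ∑ s, F.dy s (g m) * F.dy m (F.dy k (g s)) =
      ∑ m, ∑ s, F.dy m (g s) * F.dy s (F.dy k (g m)) := Finset.sum_comm
  have c5 : ∑ m, ∑ s, F.dy k (g s) * F.dy m (F.dy s (g m)) =
      ∑ m, ∑ s, F.dy k (g s) * F.dy s (F.dy m (g m)) := by
    simp only [F.dy_comm]
  have c6 : ∑ m, ∑ s, F.dy s (g m) * F.dy k (F.dy m (g s)) =
      ∑ m, ∑ s, F.dy m (g s) * F.dy s (F.dy k (g m)) := by
    rw [Finset.sum_comm]; simp only [F.dy_comm k]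
  have c7 : ∑ m, ∑ s, F.dy m (g s) * F.dy k (F.dy s (g m)) =
      ∑ m, ∑ s, F.dy m (g s) * F.dy s (F.dy k (g m)) := by
    simp only [F.dy_comm k]
  simp only [c1, c2, c3, c4, c5, c6, c7]
  ring


lemma euler_sub (a b : A) : F.euler (a - b) = F.euler a - F.euler b := by
  simp only [euler, map_sub, mul_sub, Finset.sum_sub_distrib]

lemma euler_sum {ι : Type*} (s : Finset ι) (a : ι → A) :
    F.euler (∑ i ∈ s, a i) = ∑ i ∈ s, F.euler (a i) := by
  simp only [euler, map_sum, Finset.mul_sum]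
  exact Finset.sum_comm

lemma euler_natCast (m : ℕ) : F.euler (m : A) = 0 := by
  simp [euler]

lemma euler_ofNat_two : F.euler (2 : A) = 0 := by
  simpa using F.euler_natCast 2

lemma euler_one : F.euler (1 : A) = 0 := by
  simp [euler]

lemma euler_dx (k : Fin n) (a : A) : F.euler (F.dx k a) = F.dx k (F.euler a) :=
  (F.dx_euler k a).symm

lemma euler_sprayDer {g : Fin n → A} (hg : ∀ i, F.euler (g i) = 2 * g i) (a : A) :
    F.euler (F.sprayDer g a) = F.sprayDer g (F.euler a) + F.sprayDer g a := by
  simp only [sprayDer, euler_sub, euler_sum, euler_ofNat_two, euler_mul, euler_y, euler_dx,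
    dy_euler, hg, zero_mul, add_zero, mul_add, Finset.sum_add_distrib, Finset.mul_sum]
  have h : ∑ i, 2 * (2 * g i * F.dy i a) = 2 * ∑ i, 2 * (g i * F.dy i a) := by
    rw [Finset.mul_sum]; exact Finset.sum_congr rfl fun _ _ => by ring
  rw [h]
  ring

lemma euler_riem2 {g : Fin n → A} (hg : ∀ i, F.euler (g i) = 2 * g i) (i k : Fin n) :
    F.euler (F.riem2 g i k) = 2 * F.riem2 g i k := by
  simp only [F.riem2_eq hg, euler_sub, euler_sum, euler_ofNat_two, euler_mul, euler_dx, hg, dx_two,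
    F.euler_sprayDer hg, F.euler_dy hg, Finset.sum_add_distrib]
  ring

lemma eq_zero_of_algebraMap_mul {c : ℝ} (hc : c ≠ 0) {a : A} (h : algebraMap ℝ A c * a = 0) :
    a = 0 := by
  rw [← Algebra.smul_def] at h
  simpa [smul_smul, inv_mul_cancel₀ hc] using congrArg (c⁻¹ • ·) h

lemma eq_zero_of_natCast_add_one_mul (m : ℕ) {a : A} (h : ((m : A) + 1) * a = 0) : a = 0 :=
  eq_zero_of_algebraMap_mul (c := (m : ℝ) + 1) (by positivity) (by simpa using h)

lemma eq_zero_of_natCast_sub_one_mul {m : ℕ} (hm : 2 ≤ m) {a : A} (h : ((m : A) - 1) * a = 0) :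
    a = 0 := by
  have : (2 : ℝ) ≤ m := by exact_mod_cast hm
  exact eq_zero_of_algebraMap_mul (c := (m : ℝ) - 1) (by linarith) (by simpa using h)

/-- Scalar curvature together with vanishing χ-curvature gives isotropic curvature. -/
lemma isotropic_of_chi_eq_zero (hn : 2 ≤ n) {g : Fin n → A} (hg : ∀ i, F.euler (g i) = 2 * g i)
    {r : A} (hr : ((n : A) - 1) * r = ∑ m, F.riem2 g m m)
    (hT : ∀ m i k, (r * (if m = k then 1 else 0) - F.riem2 g m k) * F.y i =
      (r * (if i = k then 1 else 0) - F.riem2 g i k) * F.y m)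
    (hχ : ∀ k, 2 * ∑ m, F.dy m (F.riem2 g m k) + F.dy k (∑ m, F.riem2 g m m) = 0)
    (i k : Fin n) :
    2 * (r * (if i = k then 1 else 0) - F.riem2 g i k) = F.dy k r * F.y i := by
  have hδ : ∀ i k m : Fin n, F.dy m (if i = k then (1 : A) else 0) = 0 := by
    intro i k m; split_ifs <;> simp
  have hr2 : F.euler r = 2 * r := by
    have h := congrArg F.euler hr
    rw [euler_sum, Finset.sum_congr rfl fun m _ => F.euler_riem2 hg m m, ← Finset.mul_sum, ← hr,
      euler_mul, euler_sub, euler_natCast, euler_one] at h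
    exact sub_eq_zero.1 (eq_zero_of_natCast_sub_one_mul hn (by linear_combination h))
  have hdr : ((n : A) - 1) * F.dy k r = F.dy k (∑ m, F.riem2 g m m) := by
    rw [← hr]; simp
  set T : A := r * (if i = k then 1 else 0) - F.riem2 g i k with hTdef
  have hET : F.euler T = 2 * T := by
    have : F.euler (if i = k then (1 : A) else 0) = 0 := by simp [euler, hδ]
    rw [hTdef, euler_sub, euler_mul, this, hr2, F.euler_riem2 hg]
    ring
  have key : (F.dy k r - ∑ m, F.dy m (F.riem2 g m k)) * F.y i + T = F.euler T + n * T := by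
    have h := Finset.sum_congr (s₁ := Finset.univ) rfl
      fun m _ => congrArg (F.dy m) (hT m i k)
    rw [← hTdef] at h
    simp only [Derivation.leibniz, map_sub, smul_eq_mul, F.dy_y, hδ, Finset.sum_add_distrib,
      if_true] at h
    have e1 : ∑ x, (r * (if x = k then 1 else 0) - F.riem2 g x k) * (if i = x then 1 else 0) =
        T := by
      simp [hTdef]
    have e2 : ∑ x, F.y i * (r * 0 + (if x = k then 1 else 0) * F.dy x r -
        F.dy x (F.riem2 g x k)) =
        (F.dy k r - ∑ m, F.dy m (F.riem2 g m k)) * F.y i := by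
      simp [← Finset.mul_sum, Finset.sum_sub_distrib, mul_comm]
    rw [e1, e2] at h
    rw [add_comm, h, euler]
    simp [add_comm]
  refine sub_eq_zero.1 (eq_zero_of_natCast_add_one_mul n ?_)
  linear_combination (-2) * key - 2 * hET - F.y i * hχ k - F.y i * hdr

section ProjectiveChange

variable {F} {g : Fin n → A} (hg : ∀ i, F.euler (g i) = 2 * g i)
  {P : A} (hP : F.euler P = P)
include hg hP

lemma euler_projective (i : Fin n) :
    F.euler (g i + P * F.y i) = 2 * (g i + P * F.y i) := by
  rw [euler_add, euler_mul, euler_y, hP, hg]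
  ring

omit hg hP in
lemma dy_projective (i k : Fin n) : F.dy k (g i + P * F.y i) =
    F.dy k (g i) + F.dy k P * F.y i + P * (if i = k then 1 else 0) := by
  rw [map_add, Derivation.leibniz, smul_eq_mul, smul_eq_mul, F.dy_y]
  ring

omit hg hP in
lemma sprayDer_projective (a : A) :
    F.sprayDer (fun i => g i + P * F.y i) a = F.sprayDer g a - 2 * P * F.euler a := by
  simp only [sprayDer, euler, add_mul, Finset.sum_add_distrib, mul_assoc, ← Finset.mul_sum]
  ring

/-- The Riemann curvature of a projectively related spray. -/
lemma riem2_projective (i k : Fin n) :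
    F.riem2 (fun i => g i + P * F.y i) i k = F.riem2 g i k +
      (P ^ 2 - F.sprayDer g P) * (if i = k then 1 else 0) +
      (2 * F.dx k P - F.sprayDer g (F.dy k P) - P * F.dy k P
        - ∑ m, F.dy m P * F.dy k (g m)) * F.y i := by
  have hδ : ∀ i k : Fin n, F.sprayDer g (if i = k then (1 : A) else 0) = 0 := by
    intro i k; split_ifs <;> simp [sprayDer]
  have hδ' : ∀ i k : Fin n, F.euler (if i = k then (1 : A) else 0) = 0 := by
    intro i k; split_ifs <;> simp [euler]
  have hPk : F.euler (F.dy k P) = 0 := by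
    have := F.dy_euler k P
    rw [hP] at this
    linear_combination -this
  have hprod : ∑ m, (F.dy m (g i) + F.dy m P * F.y i + P * (if i = m then 1 else 0)) *
      (F.dy k (g m) + F.dy k P * F.y m + P * (if m = k then 1 else 0)) =
      ∑ m, F.dy m (g i) * F.dy k (g m) + F.dy k P * (2 * g i) + 2 * P * F.dy k (g i)
      + F.y i * ∑ m, F.dy m P * F.dy k (g m) + 3 * P * F.dy k P * F.y i
      + P ^ 2 * (if i = k then 1 else 0) := by
    have e : ∀ m, (F.dy m (g i) + F.dy m P * F.y i + P * (if i = m then 1 else 0)) *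
      (F.dy k (g m) + F.dy k P * F.y m + P * (if m = k then 1 else 0)) =
      F.dy m (g i) * F.dy k (g m) + F.dy k P * (F.y m * F.dy m (g i))
      + (P * (F.dy m (g i) + F.dy m P * F.y i)) * (if m = k then 1 else 0)
      + F.y i * (F.dy m P * F.dy k (g m)) + (F.dy k P * F.y i) * (F.y m * F.dy m P)
      + (P * (F.dy k (g m) + F.dy k P * F.y m + P * (if m = k then 1 else 0)))
        * (if i = m then 1 else 0) := fun m => by ring
    have h1 : ∑ m, F.y m * F.dy m (g i) = 2 * g i := hg i
    have h2 : ∑ m, F.y m * F.dy m P = P := hP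
    rw [Finset.sum_congr rfl fun m _ => e m]
    simp only [Finset.sum_add_distrib, ← Finset.mul_sum, h1, h2, mul_ite, mul_one, mul_zero,
      Finset.sum_ite_eq, Finset.sum_ite_eq', Finset.mem_univ, if_true]
    split_ifs <;> ring
  rw [riem2_eq _ (euler_projective hg hP), F.riem2_eq hg]
  simp only [dy_projective]
  rw [hprod, sprayDer_projective]
  simp only [sprayDer_add, sprayDer_mul, euler_add, euler_mul, hδ, hδ', F.euler_dy hg, hPk, hP,
    euler_y, sprayDer_y, map_add, Derivation.leibniz, smul_eq_mul, F.dx_y]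
  ring

lemma sum_projective_factor_mul_y :
    ∑ k, (2 * F.dx k P - F.sprayDer g (F.dy k P) - P * F.dy k P
        - ∑ m, F.dy m P * F.dy k (g m)) * F.y k = F.sprayDer g P - P ^ 2 := by
  have h2 : ∑ m, F.y m * F.dy m P = P := hP
  have h1 : ∑ k, F.y k * F.sprayDer g (F.dy k P) = F.sprayDer g P + 2 * ∑ k, g k * F.dy k P := by
    have h := congrArg (F.sprayDer g) h2
    simp only [sprayDer_sum, sprayDer_mul, sprayDer_y, Finset.sum_add_distrib] at h
    rw [← h, Finset.mul_sum, add_assoc, ← Finset.sum_add_distrib]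
    simp [mul_assoc]
  have h3 : ∑ k, (∑ m, F.dy m P * F.dy k (g m)) * F.y k = 2 * ∑ m, g m * F.dy m P := by
    simp only [Finset.sum_mul, Finset.mul_sum]
    rw [Finset.sum_comm]
    refine Finset.sum_congr rfl fun m _ => ?_
    rw [← mul_assoc, ← hg, euler, Finset.sum_mul]
    exact Finset.sum_congr rfl fun _ _ => by ring
  have e : ∀ k, (2 * F.dx k P - F.sprayDer g (F.dy k P) - P * F.dy k P
        - ∑ m, F.dy m P * F.dy k (g m)) * F.y k =
      2 * (F.y k * F.dx k P) - F.y k * F.sprayDer g (F.dy k P) - P * (F.y k * F.dy k P)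
        - (∑ m, F.dy m P * F.dy k (g m)) * F.y k := fun k => by ring
  rw [Finset.sum_congr rfl fun k _ => e k]
  simp only [Finset.sum_sub_distrib, ← Finset.mul_sum, h1, h2, h3]
  rw [sprayDer]
  ring

/-- Projective changes preserve scalar curvature. -/
lemma scalar_projective (hn : 2 ≤ n) {r r' : A} (hr : ((n : A) - 1) * r = ∑ m, F.riem2 g m m)
    (hr' : ((n : A) - 1) * r' = ∑ m, F.riem2 (fun i => g i + P * F.y i) m m)
    (hT : ∀ m i k, (r * (if m = k then 1 else 0) - F.riem2 g m k) * F.y i =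
      (r * (if i = k then 1 else 0) - F.riem2 g i k) * F.y m) (m i k : Fin n) :
    (r' * (if m = k then 1 else 0) - F.riem2 (fun i => g i + P * F.y i) m k) * F.y i =
      (r' * (if i = k then 1 else 0) - F.riem2 (fun i => g i + P * F.y i) i k) * F.y m := by
  have h : r' = r + (P ^ 2 - F.sprayDer g P) := by
    refine sub_eq_zero.1 (eq_zero_of_natCast_sub_one_mul hn ?_)
    simp only [riem2_projective hg hP, Finset.sum_add_distrib, sum_projective_factor_mul_y hg hP,
      if_true, mul_one, Finset.sum_const, Finset.card_univ, Fintype.card_fin, nsmul_eq_mul] at hr'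
    linear_combination hr' - hr
  rw [riem2_projective hg hP, riem2_projective hg hP, h]
  linear_combination hT m i k

end ProjectiveChange

/-- The isotropy statement for the spray associated with the volume form `exp φ dx`. -/
lemma isotropic_of_scalar (hn : 2 ≤ n) {g : Fin n → A} (hg : ∀ i, F.euler (g i) = 2 * g i)
    {φ P r r' : A} (hφ : ∀ k, F.dy k φ = 0)
    (hP : ((n : A) + 1) * P = -(∑ m, F.dy m (g m) - ∑ m, F.y m * F.dx m φ))
    (hr : ((n : A) - 1) * r = ∑ m, F.riem2 g m m)
    (hr' : ((n : A) - 1) * r' = ∑ m, F.riem2 (fun i => g i + P * F.y i) m m)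
    (hT : ∀ m i k, (r * (if m = k then 1 else 0) - F.riem2 g m k) * F.y i =
      (r * (if i = k then 1 else 0) - F.riem2 g i k) * F.y m) (i k : Fin n) :
    2 * (r' * (if i = k then 1 else 0) - F.riem2 (fun i => g i + P * F.y i) i k) =
      F.dy k r' * F.y i := by
  have hdd : ∀ j k, F.dy j (F.dx k φ) = 0 := fun j k => by rw [← F.dx_dy, hφ, map_zero]
  have hφE : ∀ m, F.euler (F.dx m φ) = 0 := fun m => by simp [euler, hdd]
  have hEP : F.euler P = P := by
    refine sub_eq_zero.1 (eq_zero_of_natCast_add_one_mul n ?_)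
    have h := congrArg F.euler hP
    have hneg : ∀ a, F.euler (-a) = -F.euler a := fun a => by simp [euler]
    simp only [hneg, euler_mul, euler_add, euler_sub, euler_sum, euler_natCast,
      euler_one, euler_y, hφE, F.euler_dy hg, mul_zero, zero_add] at h
    linear_combination h - hP
  have hdiv : ∑ m, F.dy m (g m + P * F.y m) = ∑ m, F.y m * F.dx m φ := by
    have h2 : ∑ m, F.dy m P * F.y m = P := by
      simpa only [euler, mul_comm] using hEP
    simp only [dy_projective, Finset.sum_add_distrib, h2, if_true, mul_one, Finset.sum_const,
      Finset.card_univ, Fintype.card_fin, nsmul_eq_mul]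
    linear_combination hP
  refine F.isotropic_of_chi_eq_zero hn (euler_projective hg hEP) hr'
    (scalar_projective hg hEP hn hr hr' hT) (fun k => ?_) i k
  rw [F.dy_trace_identity (euler_projective hg hEP), hdiv]
  have : F.dy k (∑ m, F.y m * F.dx m φ) = F.dx k φ := by
    simp [F.dy_y, hdd]
  rw [this]
  simp [sprayDer, hdd, F.dx_y, F.dx_comm k]

end FiberedDiffAlg

section SmoothFunctions

open scoped ContDiff

variable {E : Type*} [NormedAddCommGroup E] [NormedSpace ℝ E]

/-- Extension by zero of a function on a subset. -/
def zeroExt {W : Set E} (f : W → ℝ) : E → ℝ := Function.extend Subtype.val f 0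

omit [NormedAddCommGroup E] [NormedSpace ℝ E] in
lemma zeroExt_apply {W : Set E} (f : W → ℝ) (p : W) : zeroExt f p = f p :=
  Subtype.val_injective.extend_apply _ _ _

/-- The algebra of smooth real functions on a set. -/
def smoothAlg (W : Set E) : Subalgebra ℝ (W → ℝ) where
  carrier := {f | ContDiffOn ℝ ∞ (zeroExt f) W}
  mul_mem' {f g} hf hg := (ContDiffOn.mul hf hg).congr fun p hp => by
    simp [zeroExt_apply _ ⟨p, hp⟩]
  add_mem' {f g} hf hg := (ContDiffOn.add hf hg).congr fun p hp => by
    simp [zeroExt_apply _ ⟨p, hp⟩]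
  algebraMap_mem' c := (contDiffOn_const (c := c)).congr fun p hp => by
    simp [zeroExt_apply _ ⟨p, hp⟩]

/-- The restriction to `W` of a function that is smooth on `W`. -/
def smoothAlgMk {W : Set E} (f : E → ℝ) (hf : ContDiffOn ℝ ∞ f W) : smoothAlg W :=
  ⟨fun p => f p, hf.congr fun p hp => zeroExt_apply _ ⟨p, hp⟩⟩

lemma smoothAlg_contDiffAt {W : Set E} (hW : IsOpen W) (f : smoothAlg W) (p : W) :
    ContDiffAt ℝ ∞ (zeroExt f.1) p :=
  ContDiffOn.contDiffAt f.2 (hW.mem_nhds p.2)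

lemma smoothAlg_differentiableAt {W : Set E} (hW : IsOpen W) (f : smoothAlg W) (p : W) :
    DifferentiableAt ℝ (zeroExt f.1) p :=
  (smoothAlg_contDiffAt hW f p).differentiableAt (by simp)

omit [NormedSpace ℝ E] in
lemma eventuallyEq_zeroExt {W : Set E} (hW : IsOpen W) {f : W → ℝ} {F : E → ℝ}
    (h : ∀ p : W, F p = f p) (p : W) : zeroExt f =ᶠ[nhds (p : E)] F := by
  filter_upwards [hW.mem_nhds p.2] with q hq
  rw [h ⟨q, hq⟩, zeroExt_apply f ⟨q, hq⟩]

/-- The derivative in a fixed direction, as a derivation of the algebra of smooth functions. -/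
def dirDeriv {W : Set E} (hW : IsOpen W) (v : E) : Derivation ℝ (smoothAlg W) (smoothAlg W) :=
  Derivation.mk'
    { toFun := fun f => smoothAlgMk (fun p => fderiv ℝ (zeroExt f.1) p v)
        ((ContDiffOn.fderiv_of_isOpen f.2 hW (by simp)).clm_apply contDiffOn_const)
      map_add' := fun f g => Subtype.ext <| funext fun p => by
        have h := (eventuallyEq_zeroExt hW (f := (f + g).1) (F := zeroExt f.1 + zeroExt g.1)
          (fun q => by simp [zeroExt_apply]) p).fderiv_eq (𝕜 := ℝ)
        rw [fderiv_add (smoothAlg_differentiableAt hW f p) (smoothAlg_differentiableAt hW g p)] at h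
        exact congrArg (· v) h
      map_smul' := fun c f => Subtype.ext <| funext fun p => by
        have h := (eventuallyEq_zeroExt hW (f := (c • f).1) (F := c • zeroExt f.1)
          (fun q => by simp [zeroExt_apply]) p).fderiv_eq (𝕜 := ℝ)
        rw [fderiv_const_smul (smoothAlg_differentiableAt hW f p)] at h
        exact congrArg (· v) h }
    (fun f g => Subtype.ext <| funext fun p => by
      have h := (eventuallyEq_zeroExt hW (f := (f * g).1) (F := zeroExt f.1 * zeroExt g.1)
        (fun q => by simp [zeroExt_apply]) p).fderiv_eq (𝕜 := ℝ)
      rw [fderiv_mul (smoothAlg_differentiableAt hW f p) (smoothAlg_differentiableAt hW g p),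
        zeroExt_apply, zeroExt_apply] at h
      exact congrArg (· v) h)

lemma dirDeriv_apply {W : Set E} (hW : IsOpen W) (v : E) (f : smoothAlg W) {F : E → ℝ}
    (h : ∀ p : W, F p = f.1 p) (p : W) : (dirDeriv hW v f).1 p = fderiv ℝ F p v := by
  rw [← (eventuallyEq_zeroExt hW h p).fderiv_eq]
  rfl

lemma dirDeriv_comm {W : Set E} (hW : IsOpen W) (v w : E) (f : smoothAlg W) :
    dirDeriv hW v (dirDeriv hW w f) = dirDeriv hW w (dirDeriv hW v f) := by
  ext p
  have hd : DifferentiableAt ℝ (fderiv ℝ (zeroExt f.1)) p :=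
    ((smoothAlg_contDiffAt hW f p).fderiv_right (m := 1) (by norm_cast)).differentiableAt (by simp)
  have key : ∀ v w : E, (dirDeriv hW v (dirDeriv hW w f)).1 p =
      fderiv ℝ (fderiv ℝ (zeroExt f.1)) p v w := fun v w => by
    rw [dirDeriv_apply hW v _ (F := fun q => fderiv ℝ (zeroExt f.1) q w) (fun q => rfl),
      fderiv_clm_apply hd (differentiableAt_const _)]
    simp
  rw [key, key]
  exact ((smoothAlg_contDiffAt hW f p).isSymmSndFDerivAt (by simp; norm_cast)) v w

end SmoothFunctions

section Coordinates

open scoped ContDiff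

/-- The slit tangent bundle over `U`. -/
abbrev slit (U : Set (Vec n)) : Set (Vec n × Vec n) := U ×ˢ {y : Vec n | y ≠ 0}

lemma isOpen_slit {U : Set (Vec n)} (hU : IsOpen U) : IsOpen (slit U) :=
  hU.prod isOpen_ne

lemma dirDeriv_clm {U : Set (Vec n)} (hU : IsOpen U) (v : Vec n × Vec n)
    (L : Vec n × Vec n →L[ℝ] ℝ) (p : slit U) :
    (dirDeriv (isOpen_slit hU) v (smoothAlgMk L L.contDiff.contDiffOn)).1 p = L v := by
  rw [dirDeriv_apply (F := L) _ _ _ fun _ => rfl, L.fderiv]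

/-- The `i`-th fiber coordinate. -/
def fiberCoord (i : Fin n) : Vec n × Vec n →L[ℝ] ℝ :=
  (ContinuousLinearMap.proj i).comp (ContinuousLinearMap.snd ℝ (Vec n) (Vec n))

/-- The algebra of smooth functions on the slit tangent bundle. -/
def slitAlg {U : Set (Vec n)} (hU : IsOpen U) : FiberedDiffAlg n (smoothAlg (slit U)) where
  dx k := dirDeriv (isOpen_slit hU) (Pi.single k 1, 0)
  dy k := dirDeriv (isOpen_slit hU) (0, Pi.single k 1)
  y i := smoothAlgMk (fiberCoord i) (fiberCoord i).contDiff.contDiffOn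
  dx_comm _ _ _ := dirDeriv_comm _ _ _ _
  dx_dy _ _ _ := dirDeriv_comm _ _ _ _
  dy_comm _ _ _ := dirDeriv_comm _ _ _ _
  dx_y k i := by
    ext p
    rw [dirDeriv_clm hU]
    simp [fiberCoord]
  dy_y k i := by
    ext p
    rw [dirDeriv_clm hU]
    split_ifs with h <;> simp [fiberCoord, h]

/-- The function `f` of `(x, y)` represents the element `a` of the algebra of smooth functions. -/
def Represents {U : Set (Vec n)} (f : Vec n → Vec n → ℝ) (a : smoothAlg (slit U)) : Prop :=
  ∀ p : slit U, f p.1.1 p.1.2 = a.1 p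

namespace Represents

variable {U : Set (Vec n)} {f f' : Vec n → Vec n → ℝ} {a a' : smoothAlg (slit U)}

lemma hasFDerivAt (hU : IsOpen U) (h : Represents f a) (p : slit U) :
    HasFDerivAt (fun q : Vec n × Vec n => f q.1 q.2)
      (fderiv ℝ (fun q : Vec n × Vec n => f q.1 q.2) p) p :=
  ((smoothAlg_differentiableAt (isOpen_slit hU) a p).congr_of_eventuallyEq
    (eventuallyEq_zeroExt (isOpen_slit hU) (F := fun q => f q.1 q.2) h p).symm).hasFDerivAt

protected lemma pdx (hU : IsOpen U) (h : Represents f a) (k : Fin n) :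
    Represents (pdx f k) ((slitAlg hU).dx k a) := fun p => by
  obtain ⟨⟨x, y⟩, hp⟩ := p
  have h1 := (h.hasFDerivAt hU ⟨(x, y), hp⟩).comp (f := fun e => (e, y)) x
    (hasFDerivAt_prodMk_left x y)
  rw [slitAlg, dirDeriv_apply _ _ a (F := fun q => f q.1 q.2) h, pdx]
  refine (congrArg (· (Pi.single k 1)) h1.fderiv).trans ?_
  simp

protected lemma pdy (hU : IsOpen U) (h : Represents f a) (k : Fin n) :
    Represents (pdy f k) ((slitAlg hU).dy k a) := fun p => by
  obtain ⟨⟨x, y⟩, hp⟩ := p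
  have h1 := (h.hasFDerivAt hU ⟨(x, y), hp⟩).comp y (hasFDerivAt_prodMk_right x y)
  rw [slitAlg, dirDeriv_apply _ _ a (F := fun q => f q.1 q.2) h, pdy]
  refine (congrArg (· (Pi.single k 1)) h1.fderiv).trans ?_
  simp

lemma add (h : Represents f a) (h' : Represents f' a') :
    Represents (fun x y => f x y + f' x y) (a + a') := fun p =>
  congrArg₂ (· + ·) (h p) (h' p)

lemma sub (h : Represents f a) (h' : Represents f' a') :
    Represents (fun x y => f x y - f' x y) (a - a') := fun p =>
  congrArg₂ (· - ·) (h p) (h' p)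

lemma mul (h : Represents f a) (h' : Represents f' a') :
    Represents (fun x y => f x y * f' x y) (a * a') := fun p =>
  congrArg₂ (· * ·) (h p) (h' p)

lemma const_mul (h : Represents f a) (c : ℝ) :
    Represents (fun x y => c * f x y) (c • a) := fun p =>
  congrArg (c * ·) (h p)

lemma sum {f : Fin n → Vec n → Vec n → ℝ} {a : Fin n → smoothAlg (slit U)}
    (h : ∀ i, Represents (f i) (a i)) :
    Represents (fun x y => ∑ i, f i x y) (∑ i, a i) := fun p => by
  rw [AddSubmonoidClass.coe_finsetSum, Finset.sum_apply]
  exact Finset.sum_congr rfl fun i _ => h i p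

lemma fiber (hU : IsOpen U) (i : Fin n) : Represents (fun _ y => y i) ((slitAlg hU).y i) :=
  fun _ => rfl

variable {G : Fin n → Vec n → Vec n → ℝ} {g : Fin n → smoothAlg (slit U)}

protected lemma Ga (hU : IsOpen U) (hg : ∀ i, Represents (G i) (g i)) (i j k : Fin n) :
    Represents (Ga G i j k) ((slitAlg hU).gam g i j k) :=
  ((hg i).pdy hU j).pdy hU k

protected lemma hd (hU : IsOpen U) (hg : ∀ i, Represents (G i) (g i)) (h : Represents f a)
    (k : Fin n) : Represents (hd G f k) ((slitAlg hU).hder g a k) :=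
  (h.pdx hU k).sub (sum fun m => ((hg m).pdy hU k).mul (h.pdy hU m))

protected lemma Riem4 (hU : IsOpen U) (hg : ∀ i, Represents (G i) (g i)) (j i k l : Fin n) :
    Represents (Riem4 G j i k l) ((slitAlg hU).riem4 g j i k l) :=
  have hΓ := Represents.Ga hU hg
  ((Represents.hd hU hg (hΓ i j l) k).sub (Represents.hd hU hg (hΓ i j k) l)).add
    (sum fun s => ((hΓ i k s).mul (hΓ s j l)).sub ((hΓ s j k).mul (hΓ i l s)))

protected lemma Riem2 (hU : IsOpen U) (hg : ∀ i, Represents (G i) (g i)) (i k : Fin n) :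
    Represents (Riem2 G i k) ((slitAlg hU).riem2 g i k) :=
  sum fun j => sum fun l => ((fiber hU j).mul (Represents.Riem4 hU hg j i k l)).mul (fiber hU l)

protected lemma Rsc (hU : IsOpen U) (hg : ∀ i, Represents (G i) (g i)) :
    Represents (Rsc G) ((1 / ((n : ℝ) - 1)) • ∑ m, (slitAlg hU).riem2 g m m) :=
  (sum fun m => Represents.Riem2 hU hg m m).const_mul _

/-- Euler's theorem for functions homogeneous of degree two in `y`. -/
lemma euler_of_homogeneous (hU : IsOpen U) (h : Represents f a)
    (hf : ∀ (x y : Vec n) (lam : ℝ), 0 < lam → f x (lam • y) = lam ^ 2 * f x y) :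
    (slitAlg hU).euler a = 2 * a := by
  ext p
  obtain ⟨⟨x, y⟩, hp⟩ := p
  have hd := (h.hasFDerivAt hU ⟨(x, y), hp⟩).comp y (hasFDerivAt_prodMk_right x y)
  have hd1 : HasFDerivAt (f x) (fderiv ℝ (f x) y) y := hd.differentiableAt.hasFDerivAt
  have hc : HasDerivAt (fun t : ℝ => t • y) y 1 := by
    simpa using (hasDerivAt_id (1 : ℝ)).smul_const y
  have h1 : HasDerivAt (fun t : ℝ => f x (t • y)) (fderiv ℝ (f x) y y) 1 := by
    have hd2 : HasFDerivAt (f x) (fderiv ℝ (f x) y) ((1 : ℝ) • y) := by simpa using hd1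
    exact hd2.comp_hasDerivAt 1 hc
  have h2 : HasDerivAt (fun t : ℝ => t ^ 2 * f x y) (2 * f x y) 1 := by
    simpa using (hasDerivAt_pow 2 (1 : ℝ)).mul_const (f x y)
  have h3 : fderiv ℝ (f x) y y = 2 * f x y := by
    refine h1.unique (h2.congr_of_eventuallyEq ?_)
    filter_upwards [lt_mem_nhds (zero_lt_one' ℝ)] with t ht using hf x y t ht
  have h4 : fderiv ℝ (f x) y y = ∑ m, y m * pdy f m x y := by
    refine (congrArg (fderiv ℝ (f x) y) (pi_eq_sum_univ' y)).trans ?_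
    simp only [map_sum, map_smul, smul_eq_mul]
    rfl
  have h5 := (sum fun m => (fiber hU m).mul (h.pdy hU m)) ⟨(x, y), hp⟩
  refine h5.symm.trans ?_
  change ∑ m, y m * pdy f m x y = 2 * a.1 ⟨(x, y), hp⟩
  rw [← h4, h3, ← h ⟨(x, y), hp⟩]

end Represents

end Coordinates

/-- if `G` is of scalar curvature, the associated spray `Ĝ` is of isotropic
curvature. -/
theorem associated_spray_isotropic_of_scalar
    {n : ℕ} (hn : 2 ≤ n) (U : Set (Vec n)) (hU : IsOpen U)
    (G : Fin n → Vec n → Vec n → ℝ) (hG : IsSpray U G)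
    (hscal : IsScalarCurv U G)
    (σ : Vec n → ℝ) (hσ : IsVolumeForm U σ) :
    IsIsotropicCurv U (Ghat G σ) := by
  obtain ⟨τ, -, hτ⟩ := hscal
  set F := slitAlg hU with hF
  let g : Fin n → smoothAlg (slit U) := fun i => smoothAlgMk _ (hG.1 i)
  have hg : ∀ i, Represents (G i) (g i) := fun i p => rfl
  have hgE : ∀ i, F.euler (g i) = 2 * g i := fun i =>
    (hg i).euler_of_homogeneous hU (hG.2 i)
  have hlog : ContDiffOn ℝ (⊤ : ℕ∞) (fun p : Vec n × Vec n => Real.log (σ p.1)) (slit U) :=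
    (hσ.1.log fun x hx => (hσ.2 x hx).ne').comp contDiffOn_fst fun p hp => hp.1
  let φ : smoothAlg (slit U) := smoothAlgMk _ hlog
  have hφ : Represents (fun x _ => Real.log (σ x)) φ := fun p => rfl
  have hφ0 : ∀ k, F.dy k φ = 0 := fun k => by
    ext p
    rw [← hφ.pdy hU k p]
    simp [pdy]
  let s : smoothAlg (slit U) := ∑ m, F.dy m (g m) - ∑ m, F.y m * F.dx m φ
  have hs : Represents (Scurv G σ) s :=
    (Represents.sum fun m => (hg m).pdy hU m).sub
      (Represents.sum fun m => (Represents.fiber hU m).mul (hφ.pdx hU m))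
  have hn1 : ((n : ℝ) + 1) ≠ 0 := by positivity
  have hn2 : ((n : ℝ) - 1) ≠ 0 := by
    have : (2 : ℝ) ≤ n := by exact_mod_cast hn
    linarith
  let P : smoothAlg (slit U) := (-1 / ((n : ℝ) + 1)) • s
  have hP : ((n : smoothAlg (slit U)) + 1) * P = -s := by
    ext p
    change ((n : ℝ) + 1) * (-1 / ((n : ℝ) + 1) * s.1 p) = -s.1 p
    field_simp
  have hGhat : ∀ i, Represents (Ghat G σ i) (g i + P * F.y i) := fun i p => by
    have := ((hg i).add ((hs.const_mul (-1 / ((n : ℝ) + 1))).mul (Represents.fiber hU i))) p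
    rw [← this, Ghat]
    ring
  have hcancel : ∀ a : smoothAlg (slit U),
      ((n : smoothAlg (slit U)) - 1) * ((1 / ((n : ℝ) - 1)) • a) = a := fun a => by
    ext p
    change ((n : ℝ) - 1) * (1 / ((n : ℝ) - 1) * a.1 p) = a.1 p
    field_simp
  have hR := Represents.Rsc hU hg
  have hR' := Represents.Rsc hU hGhat
  have hδ : ∀ (i k : Fin n) (p : slit U),
      (if i = k then (1 : smoothAlg (slit U)) else 0).1 p = if i = k then 1 else 0 := by
    intro i k p; split_ifs <;> rfl
  have hδR : ∀ i k : Fin n, Represents (U := U) (fun _ _ => if i = k then 1 else 0)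
      (if i = k then 1 else 0) := fun i k p => (hδ i k p).symm
  have main := F.isotropic_of_scalar hn hgE hφ0 hP (hcancel _) (hcancel _)
    (fun m i k => by
      ext p
      rw [← (((hR.mul (hδR m k)).sub (Represents.Riem2 hU hg m k)).mul (Represents.fiber hU i)) p,
        ← (((hR.mul (hδR i k)).sub (Represents.Riem2 hU hg i k)).mul (Represents.fiber hU m)) p]
      obtain ⟨-, h⟩ := hτ p.1.1 p.2.1 p.1.2 p.2.2
      simp only [h]
      ring)
  intro x hx y hy i k
  have e := congrFun (congrArg Subtype.val (main i k)) ⟨(x, y), hx, hy⟩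
  have e1 := ((hR'.mul (hδR i k)).sub (Represents.Riem2 hU hGhat i k)).const_mul 2 ⟨(x, y), hx, hy⟩
  have e2 := ((hR'.pdy hU k).mul (Represents.fiber hU i)) ⟨(x, y), hx, hy⟩
  have e3 := e1.trans (e.trans e2.symm)
  simp only at e3
  linarith
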